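/- Let U : ℕ × ℤ → ℝ^r solve the semi-implicit upwind scheme with grid sizes satisfying the CFL condition, with initial total variation ∑_j |U_j^0 − U_{j−1}^0| finite and U_j^0 = 0 for all sufficiently large j, and assume Assumption (★). Define the piecewise constant interpolant U^Δ(x,t) = U_j^n for (x,t) ∈ [jΔx,(j+1)Δx) × [nΔt,(n+1)Δt). Then there is a constant C > 0, independent of Δt, Δx, ε, such that for all t, t₁ > 0: ∫_ℝ |U^Δ(x,t) − U^Δ(x,t₁)| dx ≤ C ( (1/ε)(1 + λΔt/ε)^{−min{t,t₁}/Δt} ∑_j |Q(U_j^0)| Δx + 1 ) ( |t − t₁| + Δt ). -/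

import Mathlib

open scoped BigOperators

noncomputable section

/-- The 1-norm `|V| = ∑ i |v_i|` on `ℝ^r`. -/
def onenorm {r : ℕ} (V : Fin r → ℝ) : ℝ := ∑ i, |V i|

/-- The reaction term `Q(U) = (f_1, f_2 - f_1, …, f_i - f_{i-1}, …, -f_{r-1})`
for `U ∈ ℝ^r` with `r = m + 2`, built from `f_i = f_i (u_i, u_{i+1})`. -/
def Qr (m : ℕ) (f : Fin (m + 1) → ℝ → ℝ → ℝ) (U : Fin (m + 2) → ℝ) :
    Fin (m + 2) → ℝ :=
  fun k =>
    (∑ i : Fin (m + 1), if k = i.castSucc then f i (U i.castSucc) (U i.succ) else 0)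
      - ∑ i : Fin (m + 1), if k = i.succ then f i (U i.castSucc) (U i.succ) else 0

/-- The semi-implicit upwind scheme
`(U_j^{n+1} - U_j^n)/Δt + Λ⁺(U_j^n - U_{j-1}^n)/Δx + Λ⁻(U_{j+1}^n - U_j^n)/Δx
  = (1/ε) Q(U_j^{n+1})`,
where `λ_i^± = (λ_i ± |λ_i|)/2` and `Λ^± = diag(λ_1^±, …, λ_r^±)`. -/
def Scheme (m : ℕ) (f : Fin (m + 1) → ℝ → ℝ → ℝ) (lam : Fin (m + 2) → ℝ)
    (Δt Δx ε : ℝ) (U : ℕ → ℤ → Fin (m + 2) → ℝ) : Prop :=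
  ∀ (n : ℕ) (j : ℤ) (i : Fin (m + 2)),
    (U (n + 1) j i - U n j i) / Δt
      + (lam i + |lam i|) / 2 * (U n j i - U n (j - 1) i) / Δx
      + (lam i - |lam i|) / 2 * (U n (j + 1) i - U n j i) / Δx
    = (1 / ε) * Qr m f (U (n + 1) j) i

/-- The CFL condition `(Δt/Δx) · max_i |λ_i| ≤ 1`. -/
def CFL (m : ℕ) (lam : Fin (m + 2) → ℝ) (Δt Δx : ℝ) : Prop :=
  ∀ i, Δt / Δx * |lam i| ≤ 1

/-- `A_i(V, W) = ∫₀¹ ∂₁f_i(θv_i + (1-θ)w_i, θv_{i+1} + (1-θ)w_{i+1}) dθ`. -/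
def Aint (m : ℕ) (f : Fin (m + 1) → ℝ → ℝ → ℝ) (V W : Fin (m + 2) → ℝ)
    (i : Fin (m + 1)) : ℝ :=
  ∫ θ in (0 : ℝ)..1,
    deriv (fun v => f i v (θ * V i.succ + (1 - θ) * W i.succ))
      (θ * V i.castSucc + (1 - θ) * W i.castSucc)

/-- `B_i(V, W) = ∫₀¹ ∂₂f_i(θv_i + (1-θ)w_i, θv_{i+1} + (1-θ)w_{i+1}) dθ`. -/
def Bint (m : ℕ) (f : Fin (m + 1) → ℝ → ℝ → ℝ) (V W : Fin (m + 2) → ℝ)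
    (i : Fin (m + 1)) : ℝ :=
  ∫ θ in (0 : ℝ)..1,
    deriv (fun w => f i (θ * V i.castSucc + (1 - θ) * W i.castSucc) w)
      (θ * V i.succ + (1 - θ) * W i.succ)

/-- The `(r-1) × (r-1)` tridiagonal matrix `M(V, W)` with diagonal entries `A_i - B_i`,
superdiagonal entries `B_i` and subdiagonal entries `-A_{i+1}`. -/
def Mmat (m : ℕ) (f : Fin (m + 1) → ℝ → ℝ → ℝ) (V W : Fin (m + 2) → ℝ) :
    Matrix (Fin (m + 1)) (Fin (m + 1)) ℝ :=
  fun k l =>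
    if l = k then Aint m f V W k - Bint m f V W k
    else if (l : ℕ) = (k : ℕ) + 1 then Bint m f V W k
    else if (k : ℕ) = (l : ℕ) + 1 then -Aint m f V W k
    else 0

/-- **Assumption (★).** `N` is a norm `|·|_⋆` on `ℝ^{r-1}` and `lam0 = λ > 0` is such that
for all `V, W ∈ ℝ^r` and all `Δt, ε > 0` the matrix `I - (Δt/ε) M(V, W)` is invertible and
the `⋆`-operator norm of its inverse is at most `(1 + λΔt/ε)⁻¹`. -/
def StarAssumption (m : ℕ) (f : Fin (m + 1) → ℝ → ℝ → ℝ)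
    (N : (Fin (m + 1) → ℝ) → ℝ) (lam0 : ℝ) : Prop :=
  (∀ x, 0 ≤ N x) ∧ (∀ x, N x = 0 ↔ x = 0) ∧
  (∀ (c : ℝ) (x), N (c • x) = |c| * N x) ∧
  (∀ x y, N (x + y) ≤ N x + N y) ∧
  0 < lam0 ∧
  ∀ (V W : Fin (m + 2) → ℝ) (Δt ε : ℝ), 0 < Δt → 0 < ε →
    IsUnit (1 - (Δt / ε) • Mmat m f V W) ∧
    ∀ ξ : Fin (m + 1) → ℝ,
      N ((1 - (Δt / ε) • Mmat m f V W)⁻¹.mulVec ξ)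
        ≤ (1 + lam0 * Δt / ε)⁻¹ * N ξ


/-- The piecewise constant interpolant `U^Δ(x,t) = U_j^n` for
`(x,t) ∈ [jΔx, (j+1)Δx) × [nΔt, (n+1)Δt)`. -/
def interp (m : ℕ) (Δt Δx : ℝ) (U : ℕ → ℤ → Fin (m + 2) → ℝ) (x t : ℝ) :
    Fin (m + 2) → ℝ :=
  U (Int.toNat ⌊t / Δt⌋) ⌊x / Δx⌋

end

open MeasureTheory

def Ff (m : ℕ) (f : Fin (m + 1) → ℝ → ℝ → ℝ) (U : Fin (m + 2) → ℝ) : Fin (m + 1) → ℝ :=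
  fun i => f i (U i.castSucc) (U i.succ)

theorem onenorm_nonneg {r : ℕ} (V : Fin r → ℝ) : 0 ≤ onenorm V :=
  Finset.sum_nonneg fun _ _ => abs_nonneg _

theorem onenorm_add {r : ℕ} (V W : Fin r → ℝ) : onenorm (V + W) ≤ onenorm V + onenorm W := by
  unfold onenorm
  rw [← Finset.sum_add_distrib]
  exact Finset.sum_le_sum fun i _ => abs_add_le _ _

theorem onenorm_zero {r : ℕ} : onenorm (0 : Fin r → ℝ) = 0 := by simp [onenorm]

theorem onenorm_smul {r : ℕ} (c : ℝ) (V : Fin r → ℝ) : onenorm (c • V) = |c| * onenorm V := by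
  simp [onenorm, Finset.mul_sum, abs_mul]

theorem abs_le_onenorm {r : ℕ} (V : Fin r → ℝ) (i : Fin r) : |V i| ≤ onenorm V :=
  Finset.single_le_sum (f := fun i => |V i|) (fun _ _ => abs_nonneg _) (Finset.mem_univ i)

theorem eq_zero_of_onenorm {r : ℕ} (V : Fin r → ℝ) (h : onenorm V ≤ 0) : V = 0 := by
  funext i
  have := (abs_le_onenorm V i).trans h
  simpa using this

/-- summation by parts -/
theorem sum_mul_Qr (m : ℕ) (f : Fin (m + 1) → ℝ → ℝ → ℝ) (U : Fin (m + 2) → ℝ)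
    (s : Fin (m + 2) → ℝ) :
    ∑ k, s k * Qr m f U k = ∑ i, Ff m f U i * (s i.castSucc - s i.succ) := by
  unfold Qr Ff
  simp only [mul_sub, Finset.mul_sum, Finset.sum_sub_distrib]
  congr 1
  · rw [Finset.sum_comm]
    refine Finset.sum_congr rfl fun i _ => ?_
    simp [mul_comm]
  · rw [Finset.sum_comm]
    refine Finset.sum_congr rfl fun i _ => ?_
    simp [mul_comm]

theorem contraction (m : ℕ) (f : Fin (m + 1) → ℝ → ℝ → ℝ)
    (hf2 : ∀ i w, StrictAnti fun v => f i v w)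
    (hf3 : ∀ i v, StrictMono fun w => f i v w)
    (h : ℝ) (hh : 0 ≤ h) (V W : Fin (m + 2) → ℝ) :
    onenorm (V - W) ≤ onenorm ((V - h • Qr m f V) - (W - h • Qr m f W)) := by
  set s : Fin (m + 2) → ℝ := fun k => SignType.sign (V k - W k) with hs
  have h1 : onenorm (V - W) = ∑ k, s k * ((V - h • Qr m f V) - (W - h • Qr m f W)) k
      + h * ∑ i, (Ff m f V i - Ff m f W i) * (s i.castSucc - s i.succ) := by
    simp only [sub_mul, Finset.sum_sub_distrib, ← sum_mul_Qr]
    rw [mul_sub, Finset.mul_sum, Finset.mul_sum, ← Finset.sum_sub_distrib,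
      ← Finset.sum_add_distrib]
    refine Finset.sum_congr rfl fun k _ => ?_
    have : |(V - W) k| = s k * (V k - W k) := by
      simp [hs]
    rw [this]
    simp only [Pi.sub_apply, Pi.smul_apply, smul_eq_mul]
    ring
  have h2 : ∑ i, (Ff m f V i - Ff m f W i) * (s i.castSucc - s i.succ) ≤ 0 := by
    refine Finset.sum_nonpos fun i _ => ?_
    have a2 : ∀ w, Antitone fun v => f i v w := fun w => (hf2 i w).antitone
    have a3 : ∀ v, Monotone fun w => f i v w := fun v => (hf3 i v).monotone
    simp only [hs, Ff]
    rcases lt_trichotomy (V i.castSucc - W i.castSucc) 0 with h1 | h1 | h1 <;>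
    rcases lt_trichotomy (V i.succ - W i.succ) 0 with h2 | h2 | h2 <;>
    simp only [h1, h2, sign_neg, sign_pos, sign_zero, SignType.coe_neg, SignType.coe_one, SignType.coe_zero] <;>
    (have e1 := a2 (V i.succ)
     have e2 := a3 (W i.castSucc)
     first
     | (have e1 := e1 (show V i.castSucc ≤ W i.castSucc by linarith)
        have e2 := e2 (show W i.succ ≤ V i.succ by linarith)
        simp only at e1 e2
        linarith)
     | (have e1 := e1 (show W i.castSucc ≤ V i.castSucc by linarith)
        have e2 := e2 (show V i.succ ≤ W i.succ by linarith)
        simp only at e1 e2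
        linarith)
     | norm_num)
  have h3 : ∑ k, s k * ((V - h • Qr m f V) - (W - h • Qr m f W)) k ≤
      onenorm ((V - h • Qr m f V) - (W - h • Qr m f W)) := by
    refine Finset.sum_le_sum fun k _ => ?_
    refine (le_abs_self _).trans ?_
    rw [abs_mul]
    have : |s k| ≤ 1 := by
      simp only [hs]
      rcases lt_trichotomy (V k - W k) 0 with h1 | h1 | h1 <;> simp [h1]
    exact mul_le_of_le_one_left (abs_nonneg _) this
  rw [h1]
  nlinarith [mul_nonneg hh (neg_nonneg.2 h2)]

theorem partial1 (g : ℝ → ℝ → ℝ) (hg : ContDiff ℝ 1 fun p : ℝ × ℝ => g p.1 p.2) (a b : ℝ) :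
    deriv (fun v => g v b) a = fderiv ℝ (fun p : ℝ × ℝ => g p.1 p.2) (a, b) (1, 0) := by
  have hd := (hg.differentiable one_ne_zero (a, b)).hasFDerivAt
  have hc : HasDerivAt (fun v : ℝ => (v, b)) ((1 : ℝ), (0 : ℝ)) a :=
    (hasDerivAt_id a).prodMk (hasDerivAt_const a b)
  exact (hd.comp_hasDerivAt a hc).deriv

theorem partial2 (g : ℝ → ℝ → ℝ) (hg : ContDiff ℝ 1 fun p : ℝ × ℝ => g p.1 p.2) (a b : ℝ) :
    deriv (fun w => g a w) b = fderiv ℝ (fun p : ℝ × ℝ => g p.1 p.2) (a, b) (0, 1) := by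
  have hd := (hg.differentiable one_ne_zero (a, b)).hasFDerivAt
  have hc : HasDerivAt (fun v : ℝ => (a, v)) ((0 : ℝ), (1 : ℝ)) b :=
    (hasDerivAt_const b a).prodMk (hasDerivAt_id b)
  exact (hd.comp_hasDerivAt b hc).deriv

theorem ftc (m : ℕ) (f : Fin (m + 1) → ℝ → ℝ → ℝ)
    (hf1 : ∀ i, ContDiff ℝ 1 fun p : ℝ × ℝ => f i p.1 p.2) (V W : Fin (m + 2) → ℝ)
    (i : Fin (m + 1)) :
    Ff m f V i - Ff m f W i = Aint m f V W i * (V i.castSucc - W i.castSucc)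
      + Bint m f V W i * (V i.succ - W i.succ) := by
  unfold Aint Bint
  simp only [partial1 _ (hf1 i), partial2 _ (hf1 i)]
  have hcont : Continuous (fderiv ℝ (fun p : ℝ × ℝ => f i p.1 p.2)) :=
    (hf1 i).continuous_fderiv one_ne_zero
  rw [← intervalIntegral.integral_mul_const, ← intervalIntegral.integral_mul_const,
    ← intervalIntegral.integral_add]
  rotate_left
  · apply Continuous.intervalIntegrable; fun_prop
  · apply Continuous.intervalIntegrable; fun_prop
  have := intervalIntegral.integral_eq_sub_of_hasDerivAt (a := 0) (b := 1)
    (f := fun θ : ℝ => f i (θ * V i.castSucc + (1 - θ) * W i.castSucc)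
      (θ * V i.succ + (1 - θ) * W i.succ))
    (f' := fun θ => fderiv ℝ (fun p : ℝ × ℝ => f i p.1 p.2)
      (θ * V i.castSucc + (1 - θ) * W i.castSucc, θ * V i.succ + (1 - θ) * W i.succ) (1, 0) *
          (V i.castSucc - W i.castSucc) +
        fderiv ℝ (fun p : ℝ × ℝ => f i p.1 p.2)
      (θ * V i.castSucc + (1 - θ) * W i.castSucc, θ * V i.succ + (1 - θ) * W i.succ) (0, 1) *
          (V i.succ - W i.succ)) ?_ ?_
  · rw [this]; simp [Ff]
  · intro θ _
    have hd := ((hf1 i).differentiable one_ne_zero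
      (θ * V i.castSucc + (1 - θ) * W i.castSucc, θ * V i.succ + (1 - θ) * W i.succ)).hasFDerivAt
    have hl : ∀ a b : ℝ, HasDerivAt (fun θ : ℝ => θ * a + (1 - θ) * b) (a - b) θ := by
      intro a b
      have := ((hasDerivAt_id θ).mul_const a).add (((hasDerivAt_id θ).const_sub 1).mul_const b)
      exact this.congr_deriv (by ring)
    have := hd.comp_hasDerivAt θ ((hl (V i.castSucc) (W i.castSucc)).prodMk
      (hl (V i.succ) (W i.succ)))
    refine HasDerivAt.congr_deriv this ?_
    have e : (V i.castSucc - W i.castSucc, V i.succ - W i.succ) =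
        (V i.castSucc - W i.castSucc) • ((1 : ℝ), (0 : ℝ)) + (V i.succ - W i.succ) • ((0 : ℝ), (1 : ℝ)) := by
      simp
    rw [e, map_add, map_smul, map_smul, smul_eq_mul, smul_eq_mul]
    ring
  · apply Continuous.intervalIntegrable; fun_prop

theorem AB_bound (m : ℕ) (f : Fin (m + 1) → ℝ → ℝ → ℝ)
    (hf1 : ∀ i, ContDiff ℝ 1 fun p : ℝ × ℝ => f i p.1 p.2) (R : ℝ) :
    ∃ L : ℝ, 0 ≤ L ∧ ∀ V W : Fin (m + 2) → ℝ, onenorm V ≤ R → onenorm W ≤ R → ∀ i,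
      |Aint m f V W i| ≤ L ∧ |Bint m f V W i| ≤ L := by
  have h : ∀ i, ∃ L : ℝ, 0 ≤ L ∧ ∀ V W : Fin (m + 2) → ℝ, onenorm V ≤ R → onenorm W ≤ R →
      |Aint m f V W i| ≤ L ∧ |Bint m f V W i| ≤ L := by
    intro i
    have hcont : Continuous (fderiv ℝ (fun p : ℝ × ℝ => f i p.1 p.2)) :=
      (hf1 i).continuous_fderiv one_ne_zero
    obtain ⟨L, hL⟩ := (isCompact_Icc (a := (-R, -R)) (b := (R, R))).exists_bound_of_continuousOn
      hcont.continuousOn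
    refine ⟨max L 0, le_max_right _ _, fun V W hV hW => ?_⟩
    have key : ∀ θ ∈ Set.uIoc (0 : ℝ) 1, ‖fderiv ℝ (fun p : ℝ × ℝ => f i p.1 p.2)
      (θ * V i.castSucc + (1 - θ) * W i.castSucc, θ * V i.succ + (1 - θ) * W i.succ)‖ ≤ L := by
      intro θ hθ
      rw [Set.uIoc_of_le zero_le_one] at hθ
      have hb : ∀ k, -R ≤ θ * V k + (1 - θ) * W k ∧ θ * V k + (1 - θ) * W k ≤ R := by
        intro k
        have h1 := abs_le.1 ((abs_le_onenorm V k).trans hV)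
        have h2 := abs_le.1 ((abs_le_onenorm W k).trans hW)
        have h3 : 0 ≤ 1 - θ := by linarith [hθ.2]
        have h4 := hθ.1.le
        constructor <;> nlinarith
      exact hL _ ⟨⟨(hb _).1, (hb _).1⟩, ⟨(hb _).2, (hb _).2⟩⟩
    unfold Aint Bint
    simp only [partial1 _ (hf1 i), partial2 _ (hf1 i)]
    have e : ∀ v : ℝ × ℝ, ‖v‖ ≤ 1 → |∫ θ in (0 : ℝ)..1, fderiv ℝ (fun p : ℝ × ℝ => f i p.1 p.2)
      (θ * V i.castSucc + (1 - θ) * W i.castSucc, θ * V i.succ + (1 - θ) * W i.succ) v| ≤ max L 0 := by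
      intro v hv
      have := intervalIntegral.norm_integral_le_of_norm_le_const (a := (0 : ℝ)) (b := 1) (C := max L 0)
        (f := fun θ : ℝ => fderiv ℝ (fun p : ℝ × ℝ => f i p.1 p.2)
      (θ * V i.castSucc + (1 - θ) * W i.castSucc, θ * V i.succ + (1 - θ) * W i.succ) v) ?_
      · simpa using this
      · intro θ hθ
        refine (ContinuousLinearMap.le_opNorm _ _).trans ?_
        refine (mul_le_of_le_one_right (norm_nonneg _) hv).trans ((key θ hθ).trans (le_max_left _ _))
    exact ⟨e _ (by simp [Prod.norm_def]), e _ (by simp [Prod.norm_def])⟩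
  choose L hL0 hL using h
  refine ⟨∑ i, L i, Finset.sum_nonneg fun i _ => hL0 i, fun V W hV hW i => ?_⟩
  have := Finset.single_le_sum (f := L) (fun i _ => hL0 i) (Finset.mem_univ i)
  exact ⟨((hL i V W hV hW).1).trans this, ((hL i V W hV hW).2).trans this⟩

theorem M_mulVec (m : ℕ) (f : Fin (m + 1) → ℝ → ℝ → ℝ) (V W X : Fin (m + 2) → ℝ)
    (k : Fin (m + 1)) :
    (Mmat m f V W).mulVec (Ff m f X) k = Aint m f V W k * Qr m f X k.castSucc
      + Bint m f V W k * Qr m f X k.succ := by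
  unfold Matrix.mulVec dotProduct Qr
  simp only [← Finset.sum_sub_distrib, Finset.mul_sum, ← Finset.sum_add_distrib]
  refine Finset.sum_congr rfl fun l _ => ?_
  unfold Mmat Ff
  simp only [Fin.ext_iff, Fin.val_castSucc, Fin.val_succ]
  split_ifs <;> first | omega | ring

theorem norm_upper (n : ℕ) (N : (Fin n → ℝ) → ℝ) (h0 : ∀ x, 0 ≤ N x)
    (hs : ∀ (c : ℝ) (x), N (c • x) = |c| * N x) (ha : ∀ x y, N (x + y) ≤ N x + N y) :
    ∃ c : ℝ, 0 ≤ c ∧ ∀ x, N x ≤ c * onenorm x := by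
  refine ⟨∑ i, N (Pi.single i 1), Finset.sum_nonneg fun i _ => h0 _, fun x => ?_⟩
  have hz : N 0 = 0 := by simpa using hs 0 0
  have h1 : ∀ s : Finset (Fin n), N (∑ i ∈ s, x i • Pi.single i (1 : ℝ)) ≤
      ∑ i ∈ s, |x i| * N (Pi.single i 1) := by
    intro s
    induction s using Finset.induction_on with
    | empty => simp [hz]
    | insert a s ha' ih =>
      rw [Finset.sum_insert ha', Finset.sum_insert ha']
      refine (ha _ _).trans ?_
      rw [hs]
      gcongr
  have h2 : x = ∑ i, x i • Pi.single i (1 : ℝ) := by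
    funext j
    simp [Finset.sum_apply, Pi.single_apply]
  calc N x = N (∑ i, x i • Pi.single i (1 : ℝ)) := by rw [← h2]
    _ ≤ _ := h1 _
    _ ≤ ∑ i, onenorm x * N (Pi.single i 1) :=
      Finset.sum_le_sum fun i _ => mul_le_mul_of_nonneg_right (abs_le_onenorm x i) (h0 _)
    _ = _ := by rw [← Finset.mul_sum, mul_comm]

theorem norm_lower (n : ℕ) (N : (Fin n → ℝ) → ℝ) (h0 : ∀ x, 0 ≤ N x)
    (hz : ∀ x, N x = 0 ↔ x = 0)
    (hs : ∀ (c : ℝ) (x), N (c • x) = |c| * N x) (ha : ∀ x y, N (x + y) ≤ N x + N y) :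
    ∃ c : ℝ, 0 ≤ c ∧ ∀ x, onenorm x ≤ c * N x := by
  obtain ⟨c, hc0, hc⟩ := norm_upper n N h0 hs ha
  have ho : Continuous (onenorm : (Fin n → ℝ) → ℝ) := by unfold onenorm; fun_prop
  have hN : Continuous N := by
    have key : ∀ x y, |N x - N y| ≤ c * onenorm (x - y) := by
      intro x y
      have e1 := (ha (x - y) y).trans (add_le_add_left (hc (x - y)) _)
      have e2 := (ha (y - x) x).trans (add_le_add_left (hc (y - x)) _)
      have e3 : onenorm (y - x) = onenorm (x - y) := by
        simp [onenorm, abs_sub_comm]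
      rw [e3] at e2
      simp only [sub_add_cancel] at e1 e2
      rw [abs_le]; constructor <;> linarith
    rw [continuous_iff_continuousAt]
    intro x
    rw [ContinuousAt, tendsto_iff_dist_tendsto_zero]
    have lim : Filter.Tendsto (fun y => c * onenorm (y - x)) (nhds x) (nhds 0) := by
      have : Continuous fun y => c * onenorm (y - x) := by fun_prop
      have := this.tendsto x
      simpa [onenorm_zero] using this
    exact squeeze_zero (fun _ => dist_nonneg) (fun y => by rw [Real.dist_eq]; exact key y x) lim
  have hcomp : IsCompact {x : Fin n → ℝ | onenorm x = 1} := by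
    refine Metric.isCompact_of_isClosed_isBounded (isClosed_eq ho continuous_const) ?_
    refine (Metric.isBounded_closedBall (x := (0 : Fin n → ℝ)) (r := 1)).subset ?_
    intro x hx
    rw [mem_closedBall_zero_iff, pi_norm_le_iff_of_nonneg zero_le_one]
    intro i
    exact (abs_le_onenorm x i).trans (le_of_eq hx)
  rcases Set.eq_empty_or_nonempty {x : Fin n → ℝ | onenorm x = 1} with he | hne
  · refine ⟨0, le_rfl, fun x => ?_⟩
    by_contra hx
    have hx : 0 < onenorm x := by simpa using hx
    have : (onenorm x)⁻¹ • x ∈ {x : Fin n → ℝ | onenorm x = 1} := by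
      simp only [Set.mem_ofPred_eq, onenorm_smul]
      rw [abs_of_pos (inv_pos.2 hx)]; field_simp
    rw [he] at this; exact this
  · obtain ⟨x0, hx0, hmin⟩ := hcomp.exists_isMinOn hne hN.continuousOn
    have hpos : 0 < N x0 := by
      refine lt_of_le_of_ne (h0 _) fun h => ?_
      have := (hz x0).1 h.symm
      rw [this] at hx0
      simp [onenorm_zero] at hx0
    refine ⟨(N x0)⁻¹, (inv_pos.2 hpos).le, fun x => ?_⟩
    rcases (onenorm_nonneg x).eq_or_lt with hx | hx
    · rw [← hx]; exact mul_nonneg (inv_pos.2 hpos).le (h0 _)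
    have hm : (onenorm x)⁻¹ • x ∈ {x : Fin n → ℝ | onenorm x = 1} := by
      simp only [Set.mem_ofPred_eq, onenorm_smul]
      rw [abs_of_pos (inv_pos.2 hx)]; field_simp
    have := hmin hm
    simp only [Set.mem_ofPred_eq, hs, abs_of_pos (inv_pos.2 hx)] at this
    rw [inv_mul_eq_div, le_div_iff₀ hx] at this
    rw [inv_mul_eq_div, le_div_iff₀ hpos]
    linarith

noncomputable def tauv (m : ℕ) (lam : Fin (m + 2) → ℝ) (a : ℝ) (U : ℤ → Fin (m + 2) → ℝ) (j : ℤ) :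
    Fin (m + 2) → ℝ := fun i =>
  -(a * ((lam i + |lam i|) / 2) * (U j i - U (j - 1) i)
    + a * ((lam i - |lam i|) / 2) * (U (j + 1) i - U j i))

theorem scheme_eq {m : ℕ} {f : Fin (m + 1) → ℝ → ℝ → ℝ} {lam : Fin (m + 2) → ℝ}
    {Δt Δx ε : ℝ} (ht : 0 < Δt) (hx : 0 < Δx) (he : 0 < ε) {U : ℕ → ℤ → Fin (m + 2) → ℝ}
    (hS : Scheme m f lam Δt Δx ε U) (n : ℕ) (j : ℤ) :
    U (n + 1) j - (Δt / ε) • Qr m f (U (n + 1) j) = U n j + tauv m lam (Δt / Δx) (U n) j := by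
  funext i
  have := hS n j i
  simp only [Pi.sub_apply, Pi.smul_apply, Pi.add_apply, smul_eq_mul, tauv]
  field_simp at this ⊢
  linarith

theorem tv_succ {m : ℕ} {f : Fin (m + 1) → ℝ → ℝ → ℝ} {lam : Fin (m + 2) → ℝ}
    (hf2 : ∀ i w, StrictAnti fun v => f i v w)
    (hf3 : ∀ i v, StrictMono fun w => f i v w)
    {Δt Δx ε : ℝ} (ht : 0 < Δt) (hx : 0 < Δx) (he : 0 < ε) {U : ℕ → ℤ → Fin (m + 2) → ℝ}
    (hS : Scheme m f lam Δt Δx ε U) (hC : CFL m lam Δt Δx) (n : ℕ) (T : ℝ)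
    (h1 : Summable (fun j : ℤ => onenorm (U n j - U n (j - 1))))
    (h2 : (∑' j : ℤ, onenorm (U n j - U n (j - 1))) ≤ T) :
    Summable (fun j : ℤ => onenorm (U (n + 1) j - U (n + 1) (j - 1))) ∧
    (∑' j : ℤ, onenorm (U (n + 1) j - U (n + 1) (j - 1))) ≤ T := by
  set a := Δt / Δx with ha
  have ha0 : 0 < a := div_pos ht hx
  set d : ℤ → Fin (m + 2) → ℝ := fun j => U n j - U n (j - 1) with hd
  set G : ℤ → ℝ := fun j => ∑ i, ((1 - a * |lam i|) * |d j i|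
    + a * ((|lam i| + lam i) / 2) * |d (j - 1) i|
    + a * ((|lam i| - lam i) / 2) * |d (j + 1) i|) with hG
  have hle : ∀ j, onenorm (U (n + 1) j - U (n + 1) (j - 1)) ≤ G j := by
    intro j
    refine (contraction m f hf2 hf3 (Δt / ε) (div_pos ht he).le _ _).trans ?_
    rw [scheme_eq ht hx he hS, scheme_eq ht hx he hS, ← ha]
    refine Finset.sum_le_sum fun i _ => ?_
    have e : (U n j + tauv m lam a (U n) j - (U n (j - 1) + tauv m lam a (U n) (j - 1))) i =
      (1 - a * |lam i|) * d j i
    + a * ((|lam i| + lam i) / 2) * d (j - 1) i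
    + a * ((|lam i| - lam i) / 2) * d (j + 1) i := by
      simp only [hd, tauv, Pi.sub_apply, Pi.add_apply, sub_add_cancel, add_sub_cancel_right]
      ring
    rw [e]
    have p1 : 0 ≤ 1 - a * |lam i| := sub_nonneg.2 (hC i)
    have p2 : 0 ≤ a * ((|lam i| + lam i) / 2) :=
      mul_nonneg ha0.le (by linarith [neg_abs_le (lam i)])
    have p3 : 0 ≤ a * ((|lam i| - lam i) / 2) :=
      mul_nonneg ha0.le (by linarith [le_abs_self (lam i)])
    refine (abs_add_three _ _ _).trans (le_of_eq ?_)
    rw [abs_mul (1 - a * |lam i|), abs_mul (a * ((|lam i| + lam i) / 2)),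
      abs_mul (a * ((|lam i| - lam i) / 2)), abs_of_nonneg p1, abs_of_nonneg p2, abs_of_nonneg p3]
  have hsum : ∀ i, Summable fun j => |d j i| := fun i =>
    Summable.of_nonneg_of_le (fun _ => abs_nonneg _) (fun j => abs_le_onenorm (d j) i) h1
  have hT : ∀ i, HasSum (fun j => |d j i|) (∑' j, |d j i|) := fun i => (hsum i).hasSum
  have hm1 : ∀ i, HasSum (fun j => |d (j - 1) i|) (∑' j, |d j i|) := fun i =>
    (Equiv.subRight (1 : ℤ)).hasSum_iff.2 (hT i)
  have hp1 : ∀ i, HasSum (fun j => |d (j + 1) i|) (∑' j, |d j i|) := fun i =>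
    (Equiv.addRight (1 : ℤ)).hasSum_iff.2 (hT i)
  have hGs : HasSum G (∑ i, ∑' j, |d j i|) := by
    have : HasSum G (∑ i, ((1 - a * |lam i|) * (∑' j, |d j i|)
    + a * ((|lam i| + lam i) / 2) * (∑' j, |d j i|)
    + a * ((|lam i| - lam i) / 2) * (∑' j, |d j i|))) :=
      hasSum_sum fun i _ => (((hT i).mul_left _).add ((hm1 i).mul_left _)).add ((hp1 i).mul_left _)
    convert this using 2 with i
    ring
  have hD : HasSum (fun j => onenorm (d j)) (∑ i, ∑' j, |d j i|) := hasSum_sum fun i _ => hT i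
  have hs := Summable.of_nonneg_of_le (fun j => onenorm_nonneg _) hle hGs.summable
  refine ⟨hs, (hs.tsum_le_tsum hle hGs.summable).trans ?_⟩
  rw [hGs.tsum_eq, ← hD.tsum_eq]
  exact h2

theorem Qr_zero (m : ℕ) (f : Fin (m + 1) → ℝ → ℝ → ℝ) (hf0 : ∀ i, f i 0 0 = 0) :
    Qr m f 0 = 0 := by
  funext k
  simp [Qr, hf0]

theorem vanish {m : ℕ} {f : Fin (m + 1) → ℝ → ℝ → ℝ} {lam : Fin (m + 2) → ℝ}
    (hf2 : ∀ i w, StrictAnti fun v => f i v w)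
    (hf3 : ∀ i v, StrictMono fun w => f i v w)
    (hf0 : ∀ i, f i 0 0 = 0)
    {Δt Δx ε : ℝ} (ht : 0 < Δt) (hx : 0 < Δx) (he : 0 < ε) {U : ℕ → ℤ → Fin (m + 2) → ℝ}
    (hS : Scheme m f lam Δt Δx ε U) (J₀ : ℤ) (h0 : ∀ j > J₀, U 0 j = 0) (n : ℕ) :
    ∀ j > J₀ + n, U n j = 0 := by
  induction n with
  | zero => simpa using h0
  | succ n ih =>
    intro j hj
    push_cast at hj
    have hc := contraction m f hf2 hf3 (Δt / ε) (div_pos ht he).le (U (n + 1) j) 0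
    rw [scheme_eq ht hx he hS, Qr_zero m f hf0] at hc
    have e : U n j + tauv m lam (Δt / Δx) (U n) j = 0 := by
      funext i
      simp [tauv, ih j (by omega), ih (j - 1) (by omega), ih (j + 1) (by omega)]
    rw [e] at hc
    simp only [sub_zero, smul_zero, onenorm_zero] at hc
    exact eq_zero_of_onenorm _ hc

theorem tv_bound {r : ℕ} (u : ℤ → Fin r → ℝ) (T : ℝ)
    (h1 : Summable (fun j : ℤ => onenorm (u j - u (j - 1))))
    (h2 : (∑' j : ℤ, onenorm (u j - u (j - 1))) ≤ T) (J : ℤ) (hJ : ∀ j > J, u j = 0) (j : ℤ) :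
    onenorm (u j) ≤ T := by
  have key : ∀ K : ℕ, onenorm (u j) ≤ onenorm (u (j + K)) +
      ∑ k ∈ Finset.range K, onenorm (u (j + k + 1) - u (j + k + 1 - 1)) := by
    intro K
    induction K with
    | zero => simp
    | succ K ih =>
      rw [Finset.sum_range_succ]
      have e : u (j + K) = u (j + (K + 1 : ℕ)) + (-1 : ℝ) • (u (j + K + 1) - u (j + K + 1 - 1)) := by
        push_cast
        rw [add_sub_cancel_right, ← add_assoc]
        simp
      have := onenorm_add (u (j + (K + 1 : ℕ))) ((-1 : ℝ) • (u (j + K + 1) - u (j + K + 1 - 1)))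
      rw [← e, onenorm_smul] at this
      simp only [abs_neg, abs_one, one_mul] at this
      linarith
  set K := (J - j + 1).toNat with hK
  have hz : u (j + K) = 0 := hJ _ (by omega)
  have := key K
  rw [hz, onenorm_zero, zero_add] at this
  refine this.trans (le_trans ?_ h2)
  have hinj : Function.Injective fun k : ℕ => j + (k : ℤ) + 1 := by
    intro a b hab
    simp only at hab
    omega
  rw [← Finset.sum_image (s := Finset.range K) (g := fun k : ℕ => j + (k : ℤ) + 1)
    (f := fun l => onenorm (u l - u (l - 1))) (fun a _ b _ hab => hinj hab)]
  exact h1.sum_le_tsum _ (fun _ _ => onenorm_nonneg _)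

theorem onenorm_Qr_le (m : ℕ) (f : Fin (m + 1) → ℝ → ℝ → ℝ) (U : Fin (m + 2) → ℝ) :
    onenorm (Qr m f U) ≤ 2 * onenorm (Ff m f U) := by
  set s : Fin (m + 2) → ℝ := fun k => SignType.sign (Qr m f U k) with hs
  have h1 : onenorm (Qr m f U) = ∑ k, s k * Qr m f U k := by
    refine Finset.sum_congr rfl fun k _ => ?_
    simp [hs]
  have hs1 : ∀ k, |s k| ≤ 1 := by
    intro k
    simp only [hs]
    rcases lt_trichotomy (Qr m f U k) 0 with h1 | h1 | h1 <;> simp [h1]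
  rw [h1, sum_mul_Qr, onenorm, Finset.mul_sum]
  refine Finset.sum_le_sum fun i _ => (le_abs_self _).trans ?_
  rw [abs_mul, mul_comm]
  refine mul_le_mul_of_nonneg_right ?_ (abs_nonneg _)
  have := abs_sub (s i.castSucc) (s i.succ)
  linarith [hs1 i.castSucc, hs1 i.succ]

theorem onenorm_Ff_le (m : ℕ) (f : Fin (m + 1) → ℝ → ℝ → ℝ) (U : Fin (m + 2) → ℝ) :
    onenorm (Ff m f U) ≤ (m + 1) * onenorm (Qr m f U) := by
  have h : ∀ i, |Ff m f U i| ≤ onenorm (Qr m f U) := by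
    intro i
    have := sum_mul_Qr m f U (fun k => if k ≤ i.castSucc then 1 else 0)
    have e : ∑ l, Ff m f U l * ((if l.castSucc ≤ i.castSucc then (1 : ℝ) else 0)
        - (if l.succ ≤ i.castSucc then 1 else 0)) = Ff m f U i := by
      rw [Finset.sum_eq_single i]
      · simp [Fin.le_def]
      · intro b _ hb
        have hb' : (b : ℕ) ≠ i := fun h => hb (Fin.ext h)
        simp only [Fin.le_def, Fin.val_castSucc, Fin.val_succ]
        split_ifs <;> first | omega | simp
      · simp
    rw [e] at this
    rw [← this]
    refine (Finset.abs_sum_le_sum_abs _ _).trans (Finset.sum_le_sum fun k _ => ?_)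
    split_ifs <;> simp
  calc onenorm (Ff m f U) ≤ ∑ _i : Fin (m + 1), onenorm (Qr m f U) :=
        Finset.sum_le_sum fun i _ => h i
    _ = _ := by simp

theorem tau_bound (m : ℕ) (lam : Fin (m + 2) → ℝ) (a : ℝ) (ha : 0 ≤ a)
    (U : ℤ → Fin (m + 2) → ℝ) (j : ℤ) :
    onenorm (tauv m lam a U j) ≤ a * onenorm lam *
      (onenorm (U j - U (j - 1)) + onenorm (U (j + 1) - U (j + 1 - 1))) := by
  rw [add_sub_cancel_right]
  unfold onenorm
  rw [← Finset.sum_add_distrib, Finset.mul_sum]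
  refine Finset.sum_le_sum fun i _ => ?_
  have hl : |lam i| ≤ ∑ i, |lam i| := abs_le_onenorm lam i
  have e1 : |(lam i + |lam i|) / 2| ≤ ∑ i, |lam i| := by
    rw [abs_le]; constructor <;> linarith [neg_abs_le (lam i), le_abs_self (lam i), abs_nonneg (lam i)]
  have e2 : |(lam i - |lam i|) / 2| ≤ ∑ i, |lam i| := by
    rw [abs_le]; constructor <;> linarith [neg_abs_le (lam i), le_abs_self (lam i), abs_nonneg (lam i)]
  unfold tauv
  rw [abs_neg]
  refine (abs_add_le _ _).trans ?_
  rw [abs_mul, abs_mul, abs_mul, abs_mul, abs_of_nonneg ha, mul_add]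
  simp only [Pi.sub_apply]
  gcongr

theorem step_bound {m : ℕ} {f : Fin (m + 1) → ℝ → ℝ → ℝ} {lam : Fin (m + 2) → ℝ}
    (hf1 : ∀ i, ContDiff ℝ 1 fun p : ℝ × ℝ => f i p.1 p.2)
    {N : (Fin (m + 1) → ℝ) → ℝ} {lam0 : ℝ} (hstar : StarAssumption m f N lam0)
    {Δt Δx ε : ℝ} (ht : 0 < Δt) (hx : 0 < Δx) (he : 0 < ε) {U : ℕ → ℤ → Fin (m + 2) → ℝ}
    (hS : Scheme m f lam Δt Δx ε U) (c L : ℝ) (hc0 : 0 ≤ c) (hL0 : 0 ≤ L)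
    (hc : ∀ x, N x ≤ c * onenorm x) (n : ℕ) (j : ℤ)
    (hL : ∀ i, |Aint m f (U (n + 1) j) (U n j) i| ≤ L ∧ |Bint m f (U (n + 1) j) (U n j) i| ≤ L) :
    N (Ff m f (U (n + 1) j)) ≤ (1 + lam0 * Δt / ε)⁻¹ * (N (Ff m f (U n j)) +
      c * (2 * L * ((Δt / Δx) * onenorm lam *
      (onenorm (U n j - U n (j - 1)) + onenorm (U n (j + 1) - U n (j + 1 - 1)))))) := by
  obtain ⟨hN0, hNz, hNs, hNa, hl0, hM⟩ := hstar
  obtain ⟨hu, hin⟩ := hM (U (n + 1) j) (U n j) Δt ε ht he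
  set V := U (n + 1) j with hV
  set W := U n j with hW
  set τ := tauv m lam (Δt / Δx) (U n) j with hτ
  set η : Fin (m + 1) → ℝ := fun i => Aint m f V W i * τ i.castSucc + Bint m f V W i * τ i.succ
    with hη
  have hs : ∀ i, V i - W i = (Δt / ε) * Qr m f V i + τ i := by
    intro i
    have := congrFun (scheme_eq ht hx he hS n j) i
    simp only [Pi.sub_apply, Pi.smul_apply, Pi.add_apply, smul_eq_mul] at this
    linarith
  have hmul : (1 - (Δt / ε) • Mmat m f V W).mulVec (Ff m f V) = Ff m f W + η := by
    rw [Matrix.sub_mulVec, Matrix.one_mulVec, Matrix.smul_mulVec]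
    funext i
    simp only [Pi.sub_apply, Pi.smul_apply, Pi.add_apply, smul_eq_mul, M_mulVec, hη]
    have := ftc m f hf1 V W i
    rw [hs, hs] at this
    linarith
  have hF : Ff m f V = (1 - (Δt / ε) • Mmat m f V W)⁻¹.mulVec (Ff m f W + η) := by
    rw [← hmul, Matrix.mulVec_mulVec, Matrix.nonsing_inv_mul _ ((Matrix.isUnit_iff_isUnit_det _).1 hu),
      Matrix.one_mulVec]
  have hηb : onenorm η ≤ 2 * L * onenorm τ := by
    have h1 : onenorm η ≤ ∑ i : Fin (m + 1), (L * |τ i.castSucc| + L * |τ i.succ|) := by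
      refine Finset.sum_le_sum fun i _ => (abs_add_le _ _).trans ?_
      rw [abs_mul, abs_mul]
      have := hL i
      gcongr
      · exact this.1
      · exact this.2
    have h2 : onenorm τ = ∑ i : Fin (m + 1), |τ i.castSucc| + |τ (Fin.last _)| := Fin.sum_univ_castSucc _
    have h3 : onenorm τ = |τ 0| + ∑ i : Fin (m + 1), |τ i.succ| := Fin.sum_univ_succ _
    rw [Finset.sum_add_distrib, ← Finset.mul_sum, ← Finset.mul_sum] at h1
    have h4 : L * ∑ i : Fin (m + 1), |τ i.castSucc| ≤ L * onenorm τ :=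
      mul_le_mul_of_nonneg_left (by rw [h2]; linarith [abs_nonneg (τ (Fin.last _))]) hL0
    have h5 : L * ∑ i : Fin (m + 1), |τ i.succ| ≤ L * onenorm τ :=
      mul_le_mul_of_nonneg_left (by rw [h3]; linarith [abs_nonneg (τ 0)]) hL0
    linarith
  have hr : 0 ≤ (1 + lam0 * Δt / ε)⁻¹ := by positivity
  calc N (Ff m f V) = N ((1 - (Δt / ε) • Mmat m f V W)⁻¹.mulVec (Ff m f W + η)) := by rw [← hF]
    _ ≤ (1 + lam0 * Δt / ε)⁻¹ * N (Ff m f W + η) := hin _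
    _ ≤ _ := by
      refine mul_le_mul_of_nonneg_left ((hNa _ _).trans (add_le_add_right ((hc η).trans ?_) _)) hr
      refine mul_le_mul_of_nonneg_left (hηb.trans ?_) hc0
      exact mul_le_mul_of_nonneg_left (tau_bound m lam _ (div_pos ht hx).le _ _) (by positivity)

theorem step_integral (g : ℤ → ℝ) (hg : ∀ j, 0 ≤ g j) (hs : Summable g) (Δx : ℝ) (hx : 0 < Δx) :
    (∫ x : ℝ, g ⌊x / Δx⌋) ≤ Δx * ∑' j, g j := by
  have hmeas : Measurable fun x : ℝ => ⌊x / Δx⌋ := Int.measurable_floor.comp (measurable_id.div_const Δx)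
  rw [integral_eq_lintegral_of_nonneg_ae (Filter.Eventually.of_forall fun x => hg _)
    ((measurable_of_countable g).comp hmeas).aestronglyMeasurable]
  have h1 : ∫⁻ x : ℝ, ENNReal.ofReal (g ⌊x / Δx⌋) = ∑' j, ENNReal.ofReal (g j) * ENNReal.ofReal Δx := by
    rw [← lintegral_map (f := fun j : ℤ => ENNReal.ofReal (g j)) (g := fun x : ℝ => ⌊x / Δx⌋)
      (measurable_of_countable _) hmeas, lintegral_countable']
    refine tsum_congr fun j => ?_
    rw [Measure.map_apply hmeas (measurableSet_singleton j)]
    have : (fun x : ℝ => ⌊x / Δx⌋) ⁻¹' {j} = Set.Ico (j * Δx) ((j + 1) * Δx) := by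
      ext x
      simp only [Set.mem_preimage, Set.mem_singleton_iff, Int.floor_eq_iff, Set.mem_Ico,
        le_div_iff₀ hx, div_lt_iff₀ hx]
    rw [this, Real.volume_Ico]
    congr 2
    ring
  rw [h1, ENNReal.tsum_mul_right, ← ENNReal.ofReal_tsum_of_nonneg hg hs,
    ← ENNReal.ofReal_mul (tsum_nonneg hg), ENNReal.toReal_ofReal (mul_nonneg (tsum_nonneg hg) hx.le),
    mul_comm]

theorem increments (m : ℕ) (f : Fin (m + 1) → ℝ → ℝ → ℝ)
    (hf1 : ∀ i, ContDiff ℝ 1 fun p : ℝ × ℝ => f i p.1 p.2)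
    (hf2 : ∀ i w, StrictAnti fun v => f i v w)
    (hf3 : ∀ i v, StrictMono fun w => f i v w)
    (hf0 : ∀ i, f i 0 0 = 0)
    (lam : Fin (m + 2) → ℝ)
    (N : (Fin (m + 1) → ℝ) → ℝ) (lam0 : ℝ)
    (hstar : StarAssumption m f N lam0)
    (TV₀ : ℝ) :
    ∃ C > (0 : ℝ), ∀ (Δt Δx ε : ℝ), 0 < Δt → 0 < Δx → 0 < ε →
      ∀ U : ℕ → ℤ → Fin (m + 2) → ℝ,
        Scheme m f lam Δt Δx ε U → CFL m lam Δt Δx →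
        Summable (fun j : ℤ => onenorm (U 0 j - U 0 (j - 1))) →
        (∑' j : ℤ, onenorm (U 0 j - U 0 (j - 1))) ≤ TV₀ →
        (∃ J₀ : ℤ, ∀ j > J₀, U 0 j = 0) →
        Summable (fun j : ℤ => onenorm (Qr m f (U 0 j))) →
        ∀ n k : ℕ, Summable (fun j => onenorm (U (n + k) j - U n j)) ∧
          Δx * (∑' j, onenorm (U (n + k) j - U n j)) ≤
            k * Δt * (C * ((1 / ε) * ((1 + lam0 * Δt / ε)⁻¹) ^ (n + 1)
              * (∑' j : ℤ, onenorm (Qr m f (U 0 j)) * Δx) + 1)) := by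
  have hstar' := hstar
  obtain ⟨hN0, hNz, hNs, hNa, hl0, -⟩ := hstar'
  obtain ⟨c1, hc10, hc1⟩ := norm_upper _ N hN0 hNs hNa
  obtain ⟨c2, hc20, hc2⟩ := norm_lower _ N hN0 hNz hNs hNa
  set T := max TV₀ 0 with hT
  have hT0 : 0 ≤ T := le_max_right _ _
  obtain ⟨L, hL0, hL⟩ := AB_bound m f hf1 T
  have hΛ := onenorm_nonneg lam
  set Λ := onenorm lam with hΛd
  set K := c1 * (2 * L * (Λ * (2 * T))) with hK
  have hK0 : 0 ≤ K := by positivity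
  refine ⟨2 * Λ * T + 2 * c2 * K / lam0 + 2 * c2 * c1 * (m + 1) + 1, by positivity, ?_⟩
  intro Δt Δx ε ht hx he U hS hC hs0 htv0 ⟨J₀, hJ⟩ hQ0
  set ρ := (1 + lam0 * Δt / ε)⁻¹ with hρ
  have hρ0 : 0 < ρ := by positivity
  -- total variation
  have htv : ∀ n, Summable (fun j : ℤ => onenorm (U n j - U n (j - 1))) ∧
      (∑' j : ℤ, onenorm (U n j - U n (j - 1))) ≤ T := by
    intro n
    induction n with
    | zero => exact ⟨hs0, htv0.trans (le_max_left _ _)⟩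
    | succ n ih => exact tv_succ hf2 hf3 ht hx he hS hC n T ih.1 ih.2
  have hbd : ∀ n j, onenorm (U n j) ≤ T := fun n j =>
    tv_bound (U n) T (htv n).1 (htv n).2 (J₀ + n) (vanish hf2 hf3 hf0 ht hx he hS J₀ hJ n) j
  -- the sum of two neighbouring variations
  have hdd : ∀ n, ∃ v, HasSum (fun j => onenorm (U n j - U n (j - 1))
      + onenorm (U n (j + 1) - U n (j + 1 - 1))) v ∧ v ≤ 2 * T := by
    intro n
    have h1 := (htv n).1.hasSum
    have h2 := (Equiv.addRight (1 : ℤ)).hasSum_iff.2 h1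
    refine ⟨_, h1.add h2, ?_⟩
    linarith [(htv n).2]
  -- decay
  set Q0 := ∑' j : ℤ, onenorm (Qr m f (U 0 j)) with hQ0d
  have hQ00 : 0 ≤ Q0 := tsum_nonneg fun _ => onenorm_nonneg _
  have hdec : ∀ n, Summable (fun j => N (Ff m f (U n j))) ∧
      (∑' j, N (Ff m f (U n j))) ≤ ρ ^ n * (c1 * (m + 1) * Q0) + ε * K / (lam0 * Δx) := by
    intro n
    induction n with
    | zero =>
      have hle : ∀ j, N (Ff m f (U 0 j)) ≤ c1 * (m + 1) * onenorm (Qr m f (U 0 j)) := by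
        intro j
        refine (hc1 _).trans ?_
        rw [mul_assoc]
        exact mul_le_mul_of_nonneg_left (onenorm_Ff_le _ _ _) hc10
      have hsr := hQ0.mul_left (c1 * (m + 1))
      have hs := Summable.of_nonneg_of_le (fun j => hN0 _) hle hsr
      refine ⟨hs, (hs.tsum_le_tsum hle hsr).trans ?_⟩
      rw [tsum_mul_left, pow_zero, one_mul, ← hQ0d]
      have : 0 ≤ ε * K / (lam0 * Δx) := by positivity
      linarith
    | succ n ih =>
      obtain ⟨v, hv, hv2⟩ := hdd n
      have hle : ∀ j, N (Ff m f (U (n + 1) j)) ≤ _ := fun j =>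
        step_bound hf1 hstar ht hx he hS c1 L hc10 hL0 hc1 n j
          (hL _ _ (hbd (n + 1) j) (hbd n j))
      have hR := (ih.1.hasSum.add ((((hv.mul_left (Δt / Δx * onenorm lam)).mul_left
        (2 * L)).mul_left c1))).mul_left ρ
      have hs := Summable.of_nonneg_of_le (fun j => hN0 _) hle hR.summable
      refine ⟨hs, (hs.tsum_le_tsum hle hR.summable).trans ?_⟩
      rw [hR.tsum_eq]
      have e1 : c1 * (2 * L * (Δt / Δx * onenorm lam * v)) ≤ (Δt / Δx) * K := by
        rw [hK, ← hΛd]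
        have : c1 * (2 * L * (Δt / Δx * Λ * v)) ≤ c1 * (2 * L * (Δt / Δx * Λ * (2 * T))) := by
          gcongr
        refine this.trans (le_of_eq ?_)
        ring
      have e2 : ρ * (ε * K / (lam0 * Δx) + (Δt / Δx) * K) = ε * K / (lam0 * Δx) := by
        rw [hρ]
        have : ε + lam0 * Δt ≠ 0 := by positivity
        field_simp
      have e3 := mul_le_mul_of_nonneg_left (add_le_add ih.2 e1) hρ0.le
      refine e3.trans (le_of_eq ?_)
      rw [pow_succ]
      linear_combination e2
  have hρ1 : ρ ≤ 1 := by
    rw [hρ]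
    apply inv_le_one_of_one_le₀
    have : 0 ≤ lam0 * Δt / ε := by positivity
    linarith
  rw [tsum_mul_right, ← hQ0d]
  set C := 2 * Λ * T + 2 * c2 * K / lam0 + 2 * c2 * c1 * (m + 1) + 1 with hCd
  -- one step
  have hone : ∀ n, Summable (fun j => onenorm (U (n + 1) j - U n j)) ∧
      Δx * (∑' j, onenorm (U (n + 1) j - U n j)) ≤
        Δt * (C * ((1 / ε) * ρ ^ (n + 1) * (Q0 * Δx) + 1)) := by
    intro n
    obtain ⟨v, hv, hv2⟩ := hdd n
    have hle : ∀ j, onenorm (U (n + 1) j - U n j) ≤ Δt / Δx * onenorm lam *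
      (onenorm (U n j - U n (j - 1)) + onenorm (U n (j + 1) - U n (j + 1 - 1)))
        + (Δt / ε) * (2 * c2) * N (Ff m f (U (n + 1) j)) := by
      intro j
      have e : U (n + 1) j - U n j = tauv m lam (Δt / Δx) (U n) j
          + (Δt / ε) • Qr m f (U (n + 1) j) := by
        rw [sub_eq_iff_eq_add, add_right_comm, add_comm (tauv _ _ _ _ _), ← scheme_eq ht hx he hS n j]
        simp
      rw [e]
      refine (onenorm_add _ _).trans (add_le_add (tau_bound m lam _ (div_pos ht hx).le _ _) ?_)
      rw [onenorm_smul, abs_of_pos (div_pos ht he), mul_assoc]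
      refine mul_le_mul_of_nonneg_left ?_ (div_pos ht he).le
      have := onenorm_Qr_le m f (U (n + 1) j)
      have := hc2 (Ff m f (U (n + 1) j))
      linarith
    have hR := (hv.mul_left (Δt / Δx * onenorm lam)).add
      ((hdec (n + 1)).1.hasSum.mul_left ((Δt / ε) * (2 * c2)))
    have hs := Summable.of_nonneg_of_le (fun j => onenorm_nonneg _) hle hR.summable
    refine ⟨hs, ?_⟩
    have h1 := hs.tsum_le_tsum hle hR.summable
    rw [hR.tsum_eq] at h1
    have h2 : Δt / Δx * onenorm lam * v ≤ Δt / Δx * Λ * (2 * T) := by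
      rw [← hΛd]; gcongr
    have h3 := mul_le_mul_of_nonneg_left (hdec (n + 1)).2
      (show 0 ≤ (Δt / ε) * (2 * c2) by positivity)
    have h4 := mul_le_mul_of_nonneg_left (h1.trans (add_le_add h2 h3)) hx.le
    refine h4.trans ?_
    set P := (1 / ε) * ρ ^ (n + 1) * (Q0 * Δx) with hP
    have hP0 : 0 ≤ P := by positivity
    have e : Δx * (Δt / Δx * Λ * (2 * T) + Δt / ε * (2 * c2) *
        (ρ ^ (n + 1) * (c1 * (m + 1) * Q0) + ε * K / (lam0 * Δx))) =
        Δt * (2 * Λ * T + 2 * c2 * K / lam0 + 2 * c2 * c1 * (m + 1) * P) := by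
      rw [hP]
      field_simp
      ring
    rw [e]
    refine mul_le_mul_of_nonneg_left ?_ ht.le
    have q1 : 0 ≤ 2 * Λ * T := by positivity
    have q2 : 0 ≤ 2 * c2 * K / lam0 := by positivity
    have q3 : 0 ≤ 2 * c2 * c1 * (m + 1) := by positivity
    rw [hCd]
    nlinarith [mul_nonneg q1 hP0, mul_nonneg q2 hP0]
  intro n k
  induction k with
  | zero => simp [onenorm_zero, summable_zero]
  | succ k ih =>
    have h1 := hone (n + k)
    have hle : ∀ j, onenorm (U (n + (k + 1)) j - U n j) ≤ onenorm (U (n + k + 1) j - U (n + k) j)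
        + onenorm (U (n + k) j - U n j) := by
      intro j
      refine le_trans (le_of_eq ?_) (onenorm_add _ _)
      rw [sub_add_sub_cancel, add_assoc]
    have hR := h1.1.add ih.1
    have hs := Summable.of_nonneg_of_le (fun j => onenorm_nonneg _) hle hR
    refine ⟨hs, ?_⟩
    have h2 := hs.tsum_le_tsum hle hR
    rw [h1.1.tsum_add ih.1] at h2
    have h3 := mul_le_mul_of_nonneg_left h2 hx.le
    have h4 : ρ ^ (n + k + 1) ≤ ρ ^ (n + 1) := pow_le_pow_of_le_one hρ0.le hρ1 (by omega)
    have hC0 : 0 ≤ C := by positivity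
    have h5 : Δt * (C * ((1 / ε) * ρ ^ (n + k + 1) * (Q0 * Δx) + 1)) ≤
      Δt * (C * ((1 / ε) * ρ ^ (n + 1) * (Q0 * Δx) + 1)) := by gcongr
    push_cast
    linarith [h1.2, ih.2]

theorem stmt_aux (m : ℕ) (lam0 : ℝ) (hl0 : 0 < lam0) (C Δt Δx ε Q : ℝ) (hC : 0 < C) (ht : 0 < Δt)
    (hx : 0 < Δx) (he : 0 < ε) (hQ : 0 ≤ Q) (U : ℕ → ℤ → Fin (m + 2) → ℝ)
    (h : ∀ n k : ℕ, Summable (fun j => onenorm (U (n + k) j - U n j)) ∧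
          Δx * (∑' j, onenorm (U (n + k) j - U n j)) ≤
            k * Δt * (C * ((1 / ε) * ((1 + lam0 * Δt / ε)⁻¹) ^ (n + 1) * Q + 1)))
    (t t₁ : ℝ) (h0 : 0 < t) (hle : t ≤ t₁) :
    (∫ x : ℝ, onenorm (interp m Δt Δx U x t₁ - interp m Δt Δx U x t))
            ≤ C * ((1 / ε) * (1 + lam0 * Δt / ε) ^ (-(t / Δt)) * Q + 1)
                * ((t₁ - t) + Δt) := by
  set n := Int.toNat ⌊t / Δt⌋ with hn
  set n1 := Int.toNat ⌊t₁ / Δt⌋ with hn1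
  have hq : 0 ≤ t / Δt := by positivity
  have hq1 : t / Δt ≤ t₁ / Δt := by gcongr
  have hnn : n ≤ n1 := Int.toNat_le_toNat (Int.floor_le_floor hq1)
  obtain ⟨k, hk⟩ := Nat.exists_eq_add_of_le hnn
  have cn : (n : ℝ) = (⌊t / Δt⌋ : ℝ) := by
    rw [hn]; exact_mod_cast Int.toNat_of_nonneg (Int.floor_nonneg.2 hq)
  have cn1 : (n1 : ℝ) = (⌊t₁ / Δt⌋ : ℝ) := by
    rw [hn1]; exact_mod_cast Int.toNat_of_nonneg (Int.floor_nonneg.2 (hq.trans hq1))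
  have l1 : t / Δt < n + 1 := by rw [cn]; exact Int.lt_floor_add_one _
  have l2 : (n1 : ℝ) ≤ t₁ / Δt := by rw [cn1]; exact Int.floor_le _
  have hkr : (n1 : ℝ) = n + k := by exact_mod_cast hk
  have hk1 : k * Δt ≤ (t₁ - t) + Δt := by
    have h3 : (k : ℝ) ≤ t₁ / Δt - t / Δt + 1 := by linarith
    have := mul_le_mul_of_nonneg_right h3 ht.le
    refine this.trans (le_of_eq ?_)
    field_simp
  have hb : 1 ≤ 1 + lam0 * Δt / ε := by
    have : 0 ≤ lam0 * Δt / ε := by positivity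
    linarith
  have hpow : ((1 + lam0 * Δt / ε)⁻¹) ^ (n + 1) ≤ (1 + lam0 * Δt / ε) ^ (-(t / Δt)) := by
    have : ((1 + lam0 * Δt / ε)⁻¹) ^ (n + 1) = (1 + lam0 * Δt / ε) ^ (-((n : ℝ) + 1)) := by
      rw [Real.rpow_neg (by linarith), inv_pow]
      congr 1
      exact_mod_cast (Real.rpow_natCast _ (n + 1)).symm
    rw [this]
    exact Real.rpow_le_rpow_of_exponent_le hb (by linarith)
  obtain ⟨hs, hb2⟩ := h n k
  have hi := step_integral (fun j => onenorm (U (n + k) j - U n j)) (fun _ => onenorm_nonneg _) hs Δx hx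
  have : (∫ x : ℝ, onenorm (interp m Δt Δx U x t₁ - interp m Δt Δx U x t)) =
      ∫ x : ℝ, onenorm (U (n + k) ⌊x / Δx⌋ - U n ⌊x / Δx⌋) := by
    unfold interp
    rw [← hn, ← hn1, hk]
  rw [this]
  refine hi.trans (hb2.trans ?_)
  rw [mul_comm]
  have hp : 0 ≤ (1 + lam0 * Δt / ε) ^ (-(t / Δt)) := Real.rpow_nonneg (by linarith) _
  gcongr


/-- Let `U` solve the semi-implicit upwind scheme with grid sizes
satisfying the CFL condition, with finite initial total variation (bounded by `TV₀`),
`U_j^0 = 0` for all sufficiently large `j` and `∑_j |Q(U_j^0)| < ∞`; assume Assumption (★).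
Then there is a constant `C > 0`, independent of `Δt, Δx, ε`, such that for all
`t, t₁ > 0`:
`∫_ℝ |U^Δ(x,t) - U^Δ(x,t₁)| dx
   ≤ C ((1/ε)(1 + λΔt/ε)^{-min{t,t₁}/Δt} ∑_j |Q(U_j^0)| Δx + 1)(|t - t₁| + Δt)`. -/
theorem stmt17 (m : ℕ) (f : Fin (m + 1) → ℝ → ℝ → ℝ)
    (hf1 : ∀ i, ContDiff ℝ 1 fun p : ℝ × ℝ => f i p.1 p.2)
    (hf2 : ∀ i w, StrictAnti fun v => f i v w)
    (hf3 : ∀ i v, StrictMono fun w => f i v w)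
    (hf0 : ∀ i, f i 0 0 = 0)
    (lam : Fin (m + 2) → ℝ)
    (N : (Fin (m + 1) → ℝ) → ℝ) (lam0 : ℝ)
    (hstar : StarAssumption m f N lam0)
    (TV₀ : ℝ) :
    ∃ C > (0 : ℝ), ∀ (Δt Δx ε : ℝ), 0 < Δt → 0 < Δx → 0 < ε →
      ∀ U : ℕ → ℤ → Fin (m + 2) → ℝ,
        Scheme m f lam Δt Δx ε U → CFL m lam Δt Δx →
        Summable (fun j : ℤ => onenorm (U 0 j - U 0 (j - 1))) →
        (∑' j : ℤ, onenorm (U 0 j - U 0 (j - 1))) ≤ TV₀ →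
        (∃ J₀ : ℤ, ∀ j > J₀, U 0 j = 0) →
        Summable (fun j : ℤ => onenorm (Qr m f (U 0 j))) →
        ∀ t t₁ : ℝ, 0 < t → 0 < t₁ →
          (∫ x : ℝ, onenorm (interp m Δt Δx U x t - interp m Δt Δx U x t₁))
            ≤ C * ((1 / ε) * (1 + lam0 * Δt / ε) ^ (-(min t t₁ / Δt))
                    * (∑' j : ℤ, onenorm (Qr m f (U 0 j)) * Δx) + 1)
                * (|t - t₁| + Δt) := by
  obtain ⟨C, hC, h⟩ := increments m f hf1 hf2 hf3 hf0 lam N lam0 hstar TV₀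
  refine ⟨C, hC, fun Δt Δx ε ht hx he U hS hCFL h1 h2 h3 h4 t t₁ ht0 ht1 => ?_⟩
  have hinc := h Δt Δx ε ht hx he U hS hCFL h1 h2 h3 h4
  have hQ : 0 ≤ ∑' j : ℤ, onenorm (Qr m f (U 0 j)) * Δx :=
    tsum_nonneg fun _ => mul_nonneg (onenorm_nonneg _) hx.le
  have hl0 : 0 < lam0 := hstar.2.2.2.2.1
  have hsymm : ∀ a b : Fin (m + 2) → ℝ, onenorm (a - b) = onenorm (b - a) := fun a b => by
    simp [onenorm, abs_sub_comm]
  rcases le_total t t₁ with hle | hle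
  · have := stmt_aux m lam0 hl0 C Δt Δx ε _ hC ht hx he hQ U hinc t t₁ ht0 hle
    rw [min_eq_left hle, abs_sub_comm, abs_of_nonneg (sub_nonneg.2 hle)]
    simp only [hsymm (interp m Δt Δx U _ t)]
    exact this
  · have := stmt_aux m lam0 hl0 C Δt Δx ε _ hC ht hx he hQ U hinc t₁ t ht1 hle
    rw [min_eq_right hle, abs_of_nonneg (sub_nonneg.2 hle)]
    exact this
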